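/- Let d be a prime, let ζ be a primitive d-th root of unity, and let c_0 ∈ ℂ be a root of the Gleason polynomial G_{d,n} for some n ≥ 2. Set K = ℚ(c_0) and L = K(ζ). Then for every i ≥ 1, every 1 ≤ j ≤ n − 1, and every 1 ≤ ℓ ≤ d − 1, the polynomial f_{d,c_0}^i − ζ^ℓ · a_j(c_0) is irreducible over L. -/

import Mathlib

open Polynomial IntermediateField

noncomputable section

/-- The value sequence `a_i(c)`: `a_0 = 0`, `a_{i+1} = a_i ^ d + c`. -/
def aSeq (d : ℕ) {F : Type*} [CommRing F] (c : F) : ℕ → F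
  | 0 => 0
  | i + 1 => aSeq d c i ^ d + c

/-- The polynomials `a_i ∈ ℤ[c]`: `a_0 = 0`, `a_{i+1} = a_i ^ d + c`. -/
def aPoly (d : ℕ) : ℕ → Polynomial ℤ
  | 0 => 0
  | i + 1 => aPoly d i ^ d + X

/-- Iterates of `f_{d,c} = x^d + c`: `f^0 = x`, `f^{k+1} = f ∘ f^k`. -/
def fIter (d : ℕ) {F : Type*} [CommRing F] (c : F) : ℕ → Polynomial F
  | 0 => X
  | k + 1 => fIter d c k ^ d + C c

/-- `c₀` is a root of the Gleason polynomial `G_{d,n} = ∏_{k ∣ n} a_k^{μ(n/k)}`. -/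
def isGleasonRoot (d n : ℕ) (c₀ : ℂ) : Prop :=
  ∃ g : Polynomial ℤ,
    g * ∏ k ∈ n.divisors, aPoly d k ^ ((-(ArithmeticFunction.moebius (n / k))).toNat)
        = ∏ k ∈ n.divisors, aPoly d k ^ ((ArithmeticFunction.moebius (n / k)).toNat)
    ∧ Polynomial.aeval c₀ g = 0

/-- `c₀` is a root of the Misiurewicz polynomial `G_{d,m,n}^ζ`. -/
def isMisiurewiczRoot (d m n : ℕ) (ζ c₀ : ℂ) : Prop :=
  ∃ g : Polynomial ℂ,
    g * ((∏ k ∈ n.divisors,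
            ((aPoly d (m + k - 1)).map (Int.castRingHom ℂ) -
              C ζ * (aPoly d (m - 1)).map (Int.castRingHom ℂ))
                ^ ((-(ArithmeticFunction.moebius (n / k))).toNat)) *
          (if n ∣ (m - 1) then
            ∏ k ∈ n.divisors, ((aPoly d k).map (Int.castRingHom ℂ))
                ^ ((ArithmeticFunction.moebius (n / k)).toNat)
          else 1))
        = (∏ k ∈ n.divisors,
            ((aPoly d (m + k - 1)).map (Int.castRingHom ℂ) -
              C ζ * (aPoly d (m - 1)).map (Int.castRingHom ℂ))
                ^ ((ArithmeticFunction.moebius (n / k)).toNat)) *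
          (if n ∣ (m - 1) then
            ∏ k ∈ n.divisors, ((aPoly d k).map (Int.castRingHom ℂ))
                ^ ((-(ArithmeticFunction.moebius (n / k))).toNat)
          else 1)
    ∧ g.eval c₀ = 0

/-- The polynomial `F_{k,i}^{(d,c₀)} = ∏_{j=1}^{d-1} (f_{d,c₀}^k - ζ^j a_i(c₀))` over `ℂ`. -/
def FPoly (d : ℕ) (c₀ ζ : ℂ) (k i : ℕ) : Polynomial ℂ :=
  ∏ j ∈ Finset.Icc 1 (d - 1), (fIter d c₀ k - C (ζ ^ j * aSeq d c₀ i))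


section Sequences

variable {R S : Type*} [CommRing R] [CommRing S] (d : ℕ)

lemma map_aSeq (φ : R →+* S) (c : R) (m : ℕ) : φ (aSeq d c m) = aSeq d (φ c) m := by
  induction m with
  | zero => simp [aSeq]
  | succ m ih => simp [aSeq, ih]

lemma map_fIter (φ : R →+* S) (c : R) (m : ℕ) : (fIter d c m).map φ = fIter d (φ c) m := by
  induction m with
  | zero => simp [fIter]
  | succ m ih => simp [fIter, ih]

lemma aeval_aPoly (c : R) (m : ℕ) : aeval c (aPoly d m) = aSeq d c m := by
  induction m with
  | zero => simp [aPoly, aSeq]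
  | succ m ih => simp [aPoly, aSeq, ih]

lemma eval_fIter (c : R) (s m : ℕ) : (fIter d c m).eval (aSeq d c s) = aSeq d c (s + m) := by
  induction m with
  | zero => simp [fIter]
  | succ m ih => simp [fIter, ih, aSeq]

variable {d}

lemma aSeq_periodic {c : R} {k : ℕ} (hk : aSeq d c k = 0) :
    Function.Periodic (aSeq d c) k := by
  intro m
  induction m with
  | zero => simpa [aSeq] using hk
  | succ m ih => rw [add_right_comm, aSeq, aSeq, ih]

/-- The indices at which the critical orbit returns to `0` are the multiples of one number. -/
lemma exists_aSeq_eq_zero_iff_dvd (c : R) : ∃ k, ∀ m, aSeq d c m = 0 ↔ k ∣ m := by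
  classical
  by_cases h : ∃ k, 0 < k ∧ aSeq d c k = 0
  · have hpos := (Nat.find_spec h).1
    have hper := aSeq_periodic (Nat.find_spec h).2
    refine ⟨Nat.find h, fun m => ?_⟩
    rw [← hper.map_mod_nat m, Nat.dvd_iff_mod_eq_zero]
    refine ⟨fun h0 => ?_, fun h0 => by rw [h0, aSeq]⟩
    by_contra hne
    exact Nat.find_min h (Nat.mod_lt m hpos) ⟨Nat.pos_of_ne_zero hne, h0⟩
  · refine ⟨0, fun m => ?_⟩
    rw [zero_dvd_iff]
    refine ⟨fun h0 => ?_, fun h0 => by rw [h0, aSeq]⟩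
    by_contra hne
    exact h ⟨m, Nat.pos_of_ne_zero hne, h0⟩

/-- Rigid divisibility: a proper return time yields a unit. -/
lemma isUnit_aSeq [IsDomain R] (hd : 2 ≤ d) {c : R} {n j : ℕ} (hn : aSeq d c n = 0)
    (hn0 : 0 < n) (hj : aSeq d c j ≠ 0) : IsUnit (aSeq d c j) := by
  have hpow : ∀ m (x : R), x ^ d ∣ (fIter d c (m + 1)).eval x - aSeq d c (m + 1) := by
    intro m x
    induction m with
    | zero => simp [fIter, aSeq, show d ≠ 0 by omega]
    | succ m ih =>
      have h : (fIter d c (m + 1 + 1)).eval x - aSeq d c (m + 1 + 1) =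
          (fIter d c (m + 1)).eval x ^ d - aSeq d c (m + 1) ^ d := by
        rw [fIter, aSeq]; simp
      rw [h]
      exact ih.trans (sub_dvd_pow_sub_pow _ _ d)
  obtain ⟨j, rfl⟩ : ∃ i, j = i + 1 :=
    Nat.exists_eq_succ_of_ne_zero (by rintro rfl; exact hj rfl)
  set a := aSeq d c (j + 1) with ha
  have hmul : ∀ k, a ^ d ∣ aSeq d c ((k + 1) * (j + 1)) - a := by
    intro k
    induction k with
    | zero => simp [ha]
    | succ k ih =>
      have hdvd : a ∣ aSeq d c ((k + 1) * (j + 1)) := by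
        have := (dvd_pow_self a (by omega : d ≠ 0)).trans ih
        simpa using dvd_add this (dvd_refl a)
      have := hpow j (aSeq d c ((k + 1) * (j + 1)))
      rw [eval_fIter, ← ha] at this
      rw [show (k + 1 + 1) * (j + 1) = (k + 1) * (j + 1) + (j + 1) by ring]
      exact (pow_dvd_pow_of_dvd hdvd d).trans this
  have h0 : aSeq d c (n * (j + 1)) = 0 := by
    have := (aSeq_periodic hn).nat_mul_eq (j + 1)
    simpa [mul_comm, aSeq] using this
  have h1 := hmul (n - 1)
  rw [Nat.sub_add_cancel hn0, h0, zero_sub, dvd_neg] at h1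
  obtain ⟨e, rfl⟩ : ∃ e, d = e + 2 := ⟨d - 2, by omega⟩
  obtain ⟨b, hb⟩ := h1
  refine IsUnit.of_mul_eq_one (a ^ e * b) (mul_left_cancel₀ hj ?_)
  linear_combination -hb

lemma fIter_monic_natDegree [Nontrivial R] (hd : 0 < d) (c : R) (m : ℕ) :
    (fIter d c m).Monic ∧ (fIter d c m).natDegree = d ^ m := by
  induction m with
  | zero => simp [fIter, monic_X]
  | succ m ih =>
    have hdeg : (fIter d c m ^ d).natDegree = d ^ (m + 1) := by
      rw [ih.1.natDegree_pow, ih.2]; ring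
    have hlt : (C c).degree < (fIter d c m ^ d).degree := by
      refine degree_C_le.trans_lt (natDegree_pos_iff_degree_pos.mp ?_)
      rw [hdeg]; positivity
    refine ⟨(ih.1.pow d).add_of_left hlt, ?_⟩
    rw [fIter, natDegree_add_eq_left_of_degree_lt hlt, hdeg]

lemma fIter_comp_X_add_C_of_char (hd : d.Prime) [CharP R d] (c a : R) (m : ℕ) :
    (fIter d c m).comp (X + C a) = X ^ d ^ m + C ((fIter d c m).eval a) := by
  have := Fact.mk hd
  induction m with
  | zero => simp [fIter]
  | succ m ih =>
    simp only [fIter, add_comp, pow_comp, ih, C_comp, eval_add, eval_pow, eval_C, C_add, C_pow]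
    rw [add_pow_char, ← pow_mul, ← pow_succ, add_assoc]

lemma aPoly_monic_natDegree (hd : 2 ≤ d) (m : ℕ) :
    (aPoly d (m + 1)).Monic ∧ (aPoly d (m + 1)).natDegree = d ^ m := by
  induction m with
  | zero => simp [aPoly, monic_X, show d ≠ 0 by omega]
  | succ m ih =>
    have hdeg : (aPoly d (m + 1) ^ d).natDegree = d ^ (m + 1) := by
      rw [ih.1.natDegree_pow, ih.2]; ring
    have hlt : (X : ℤ[X]).natDegree < (aPoly d (m + 1) ^ d).natDegree := by
      rw [hdeg, natDegree_X]
      exact Nat.one_lt_pow (by omega) hd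
    rw [aPoly]
    exact ⟨(ih.1.pow d).add_of_left (degree_lt_degree hlt),
      by rw [natDegree_add_eq_left_of_natDegree_lt hlt, hdeg]⟩

lemma isIntegral_of_aSeq_eq_zero (hd : 2 ≤ d) {c : R} {n : ℕ} (hn0 : 0 < n)
    (hn : aSeq d c n = 0) : IsIntegral ℤ c := by
  obtain ⟨m, rfl⟩ : ∃ m, n = m + 1 := ⟨n - 1, by omega⟩
  exact ⟨aPoly d (m + 1), (aPoly_monic_natDegree hd m).1, by
    rw [← aeval_def, aeval_aPoly, hn]⟩

lemma exists_derivative_aPoly (d : ℕ) {m : ℕ} (hm : 0 < m) :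
    ∃ q : ℤ[X], derivative (aPoly d m) = 1 + (d : ℤ[X]) * q := by
  obtain ⟨m, rfl⟩ : ∃ i, m = i + 1 := ⟨m - 1, by omega⟩
  exact ⟨aPoly d m ^ (d - 1) * derivative (aPoly d m), by
    simp [aPoly, derivative_pow]; ring⟩

end Sequences

section Gleason

lemma rootMultiplicity_prod_pow {F ι : Type*} [Field F] (s : Finset ι) (p : ι → F[X])
    (e : ι → ℕ) (hp : ∀ k ∈ s, p k ≠ 0) (x : F) :
    (∏ k ∈ s, p k ^ e k).rootMultiplicity x = ∑ k ∈ s, e k * (p k).rootMultiplicity x := by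
  classical
  rw [← count_roots, roots_prod _ _ (Finset.prod_ne_zero_iff.mpr fun k hk => pow_ne_zero _ (hp k hk)),
    Multiset.count_bind]
  simp only [roots_pow, Multiset.count_nsmul, count_roots]
  rfl

lemma not_isIntegral_of_one_add_mul_eq_zero {d : ℕ} (hd : 2 ≤ d) {β : ℂ}
    (h : 1 + (d : ℂ) * β = 0) : ¬ IsIntegral ℤ β := by
  intro hβ
  have hd0 : (d : ℂ) ≠ 0 := by exact_mod_cast (by omega : d ≠ 0)
  have hq : β = algebraMap ℚ ℂ (-1 / d) := by
    simp only [map_div₀, map_neg, map_one, map_natCast]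
    field_simp
    linear_combination h
  rw [hq, isIntegral_algebraMap_iff (algebraMap ℚ ℂ).injective] at hβ
  obtain ⟨z, hz⟩ := IsIntegrallyClosed.isIntegral_iff.mp hβ
  have hd1 : (d : ℚ) ≠ 0 := by exact_mod_cast (by omega : d ≠ 0)
  have h1 : (d : ℤ) * z = -1 := by
    have : (d : ℚ) * z = -1 := by
      rw [eq_intCast] at hz
      rw [hz]; field_simp
    exact_mod_cast this
  have h2 : (d : ℤ) ∣ 1 := ⟨-z, by linarith⟩
  have := Int.le_of_dvd one_pos h2
  omega

lemma rootMultiplicity_aPoly {d : ℕ} (hd : 2 ≤ d) {m : ℕ} (hm : 0 < m) (c : ℂ) :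
    ((aPoly d m).map (Int.castRingHom ℂ)).rootMultiplicity c =
      open Classical in if aSeq d c m = 0 then 1 else 0 := by
  have hne : (aPoly d m).map (Int.castRingHom ℂ) ≠ 0 := by
    obtain ⟨m, rfl⟩ : ∃ i, m = i + 1 := ⟨m - 1, by omega⟩
    exact ((aPoly_monic_natDegree hd m).1.map _).ne_zero
  have heval : ∀ q : ℤ[X], (q.map (Int.castRingHom ℂ)).eval c = aeval c q := fun q => by
    rw [eval_map, aeval_def]; rfl
  split_ifs with h
  · have hroot : ((aPoly d m).map (Int.castRingHom ℂ)).IsRoot c := by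
      rw [IsRoot, heval, aeval_aPoly, h]
    refine le_antisymm (not_lt.mp fun hlt => ?_) ((rootMultiplicity_pos hne).mpr hroot)
    obtain ⟨q, hq⟩ := exists_derivative_aPoly d hm
    have h1 := ((one_lt_rootMultiplicity_iff_isRoot hne).mp hlt).2
    rw [IsRoot, derivative_map, heval, hq] at h1
    simp only [map_add, map_mul, map_one, map_natCast] at h1
    refine not_isIntegral_of_one_add_mul_eq_zero hd h1 ?_
    exact adjoin_le_integralClosure (isIntegral_of_aSeq_eq_zero hd hm h)
      (aeval_mem_adjoin_singleton ℤ c)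
  · refine rootMultiplicity_eq_zero fun hroot => h ?_
    rwa [IsRoot, heval, aeval_aPoly] at hroot

/-- A root of the `n`-th Gleason polynomial is a parameter for which `0` has exact period `n`. -/
lemma isGleasonRoot.exact_period {d n : ℕ} (hd : 2 ≤ d) (hn : 0 < n) {c : ℂ}
    (h : isGleasonRoot d n c) : ∀ m, aSeq d c m = 0 ↔ n ∣ m := by
  classical
  obtain ⟨g, hg, hgc⟩ := h
  obtain ⟨k, hk⟩ := exists_aSeq_eq_zero_iff_dvd (d := d) c
  let p : ℕ → ℂ[X] := fun m => (aPoly d m).map (Int.castRingHom ℂ)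
  have hp0 : ∀ m ∈ n.divisors, p m ≠ 0 := by
    intro m hm
    obtain ⟨m, rfl⟩ : ∃ i, m = i + 1 := ⟨m - 1, by have := Nat.pos_of_mem_divisors hm; omega⟩
    exact ((aPoly_monic_natDegree hd m).1.map _).ne_zero
  have hg' := congrArg (Polynomial.map (Int.castRingHom ℂ)) hg
  simp only [Polynomial.map_mul, Polynomial.map_prod, Polynomial.map_pow] at hg'
  have hR : ∏ k ∈ n.divisors, p k ^ (ArithmeticFunction.moebius (n / k)).toNat ≠ 0 :=
    Finset.prod_ne_zero_iff.mpr fun k hk => pow_ne_zero _ (hp0 k hk)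
  have hL := hg'.trans_ne hR
  have hgroot : 0 < (g.map (Int.castRingHom ℂ)).rootMultiplicity c := by
    rw [rootMultiplicity_pos (left_ne_zero_of_mul hL), IsRoot, eval_map]
    exact hgc
  have hmult := congrArg (rootMultiplicity c) hg'
  rw [rootMultiplicity_mul hL, rootMultiplicity_prod_pow _ p _ hp0,
    rootMultiplicity_prod_pow _ p _ hp0] at hmult
  have hsum : 0 < ∑ m ∈ n.divisors,
      ArithmeticFunction.moebius (n / m) * ((p m).rootMultiplicity c : ℤ) := by
    have hsplit : ∀ m, ArithmeticFunction.moebius (n / m) * ((p m).rootMultiplicity c : ℤ) =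
        (((ArithmeticFunction.moebius (n / m)).toNat * (p m).rootMultiplicity c : ℕ) : ℤ) -
        (((-ArithmeticFunction.moebius (n / m)).toNat * (p m).rootMultiplicity c : ℕ) : ℤ) := by
      intro m
      push_cast
      rw [← sub_mul, Int.toNat_sub_toNat_neg]
    simp_rw [hsplit]
    rw [Finset.sum_sub_distrib, ← Nat.cast_sum, ← Nat.cast_sum, ← hmult]
    push_cast
    linarith [(Nat.cast_pos (α := ℤ)).mpr hgroot]
  have hmoeb := (ArithmeticFunction.sum_eq_iff_sum_mul_moebius_eq (R := ℤ)
    (f := fun i => if i = k then 1 else 0) (g := fun m => if k ∣ m then 1 else 0)).mp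
    (fun m hm => by simp [Finset.sum_ite_eq', hm.ne']) n hn
  simp only [Int.cast_id] at hmoeb
  rw [Nat.sum_divisorsAntidiagonal' (f := fun a b =>
    ArithmeticFunction.moebius a * if k ∣ b then 1 else 0)] at hmoeb
  have hnk : n = k := by
    by_contra hne
    rw [if_neg hne] at hmoeb
    refine hsum.ne' (Eq.trans (Finset.sum_congr rfl fun m hm => ?_) hmoeb)
    rw [rootMultiplicity_aPoly hd (Nat.pos_of_mem_divisors hm)]
    simp [hk]
  rwa [hnk]

end Gleason

section Eisenstein

lemma irreducible_fIter_sub_C {R : Type*} [CommRing R] [IsDomain R] {d : ℕ} (hd : d.Prime)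
    {P : Ideal R} (hP : P.IsPrime) (hdP : (d : R) ∈ P) (c a b : R) (i : ℕ)
    (hmem : (fIter d c i).eval a - b ∈ P) (hnot : (fIter d c i).eval a - b ∉ P ^ 2) :
    Irreducible (fIter d c i - C b) := by
  obtain ⟨hmon, hdeg⟩ := fIter_monic_natDegree hd.pos c i
  have hpos : 0 < d ^ i := pow_pos hd.pos i
  have hlt : (C b).degree < (fIter d c i).degree :=
    degree_C_le.trans_lt (natDegree_pos_iff_degree_pos.mp (hdeg ▸ hpos))
  have hmon' : (fIter d c i - C b).Monic := hmon.sub_of_left hlt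
  have hdeg' : (fIter d c i - C b).natDegree = d ^ i := by
    rw [natDegree_sub_C, hdeg]
  rw [← MulEquiv.irreducible_iff (taylorEquiv a)]
  change Irreducible (taylor a (fIter d c i - C b))
  have hmonT : (taylor a (fIter d c i - C b)).Monic := by
    rw [Monic, leadingCoeff_taylor]; exact hmon'
  refine IsEisensteinAt.irreducible (𝓟 := P) ⟨?_, ?_, ?_⟩ hP hmonT.isPrimitive ?_
  · rw [hmonT.leadingCoeff]
    exact (Ideal.ne_top_iff_one P).mp hP.ne_top
  · intro k hk
    rw [natDegree_taylor, hdeg'] at hk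
    have : CharP (R ⧸ P) d := by
      have := (Ideal.Quotient.nontrivial_iff (I := P)).mpr hP.ne_top
      refine (CharP.charP_iff_prime_eq_zero hd).mpr ?_
      rw [← map_natCast (Ideal.Quotient.mk P)]
      exact Ideal.Quotient.eq_zero_iff_mem.mpr hdP
    have key : (taylor a (fIter d c i - C b)).map (Ideal.Quotient.mk P) = X ^ d ^ i := by
      have h0 := Ideal.Quotient.eq_zero_iff_mem.mpr hmem
      rw [map_sub, ← eval_map_apply, map_fIter] at h0
      rw [taylor_apply, Polynomial.map_comp]
      simp only [Polynomial.map_sub, Polynomial.map_add, map_X, map_C, map_fIter, sub_comp, C_comp]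
      rw [fIter_comp_X_add_C_of_char hd, add_sub_assoc, ← C_sub, h0, C_0, add_zero]
    have := congrArg (fun q => q.coeff k) key
    simp only [coeff_map, coeff_X_pow, if_neg hk.ne] at this
    exact Ideal.Quotient.eq_zero_iff_mem.mp this
  · rwa [taylor_coeff_zero, eval_sub, eval_C]
  · rw [natDegree_taylor, hdeg']; exact hpos

lemma irreducible_fIter_sub_C_mul_aSeq {R K : Type*} [CommRing R] [IsDomain R]
    [IsIntegrallyClosed R] [Field K] [Algebra R K] [IsFractionRing R K] {d : ℕ} (hd : d.Prime)
    {P : Ideal R} (hP : P.IsPrime) (hdP : (d : R) ∈ P) {c w : R} (hwP : w - 1 ∈ P)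
    (hwP2 : w - 1 ∉ P ^ 2) {n j : ℕ} (hn0 : 0 < n) (hn : aSeq d c n = 0) (hj : aSeq d c j ≠ 0)
    (i : ℕ) :
    Irreducible (fIter d (algebraMap R K c) i -
      C (algebraMap R K w * aSeq d (algebraMap R K c) j)) := by
  have hunit := isUnit_aSeq hd.two_le hn hn0 hj
  obtain ⟨s, hs⟩ : ∃ s, aSeq d c (s + i) = aSeq d c j := by
    refine ⟨i * n - i + j, ?_⟩
    have hle : i ≤ i * n := Nat.le_mul_of_pos_right i hn0
    rw [show i * n - i + j + i = j + i * n by omega]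
    exact (aSeq_periodic hn).nat_mul i j
  have hconst : (fIter d c i).eval (aSeq d c s) - w * aSeq d c j = -(aSeq d c j * (w - 1)) := by
    rw [eval_fIter, hs]; ring
  have hirr := irreducible_fIter_sub_C hd hP hdP c (aSeq d c s) (w * aSeq d c j) i
    (by rw [hconst]; exact P.neg_mem (P.mul_mem_left _ hwP))
    (by rwa [hconst, neg_mem_iff, Ideal.unit_mul_mem_iff_mem _ hunit])
  have hmon : (fIter d c i - C (w * aSeq d c j)).Monic := by
    obtain ⟨h1, h2⟩ := fIter_monic_natDegree hd.pos c i
    refine h1.sub_of_left (degree_C_le.trans_lt (natDegree_pos_iff_degree_pos.mp ?_))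
    rw [h2]; exact pow_pos hd.pos i
  have := (hmon.irreducible_iff_irreducible_map_fraction_map (K := K)).mp hirr
  rwa [Polynomial.map_sub, map_fIter, map_C, map_mul, map_aSeq] at this

end Eisenstein

section NumberField

open NumberField

lemma exists_prime_of_cyclotomic {F L : Type*} [Field F] [NumberField F] [Field L] [NumberField L]
    [Algebra F L] {d : ℕ} [hd : Fact d.Prime] [IsCyclotomicExtension {d} ℚ F] {ζ : F}
    (hζ : IsPrimitiveRoot ζ d) {c : 𝓞 L} (hc : Algebra.adjoin F {(c : L)} = ⊤)
    {n : ℕ} (hn0 : 0 < n) (hn : aSeq d c n = 0) :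
    ∃ P : Ideal (𝓞 L), P.IsPrime ∧ (d : 𝓞 L) ∈ P ∧
      algebraMap (𝓞 F) (𝓞 L) (hζ.toInteger - 1) ∈ P ∧
      algebraMap (𝓞 F) (𝓞 L) (hζ.toInteger - 1) ∉ P ^ 2 := by
  set π : 𝓞 F := hζ.toInteger - 1 with hπdef
  have hπ : Prime π := hζ.zeta_sub_one_prime'
  have hp0 : Ideal.span {π} ≠ ⊥ := by simpa using hπ.ne_zero
  have hpp : (Ideal.span {π}).IsPrime := (Ideal.span_singleton_prime hπ.ne_zero).mpr hπ
  have hpm : (Ideal.span {π}).IsMaximal := hpp.isMaximal hp0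
  obtain ⟨P, hPm, hPo⟩ :=
    Ideal.exists_maximal_ideal_liesOver_of_isIntegral (S := 𝓞 L) (Ideal.span {π})
  have hmap : ∀ x ∈ Ideal.span {π}, algebraMap (𝓞 F) (𝓞 L) x ∈ P := fun x hx => by
    rw [hPo.over] at hx; exact hx
  have hdP : (d : 𝓞 L) ∈ P := by
    have := hmap (d : 𝓞 F) (Ideal.mem_span_singleton.mpr hζ.toInteger_sub_one_dvd_prime')
    simpa using this
  refine ⟨P, hPm.isPrime, hdP, hmap _ (Ideal.mem_span_singleton_self π), fun hsq => ?_⟩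
  have hdvd : P ^ 2 ∣ (Ideal.span {π}).map (algebraMap (𝓞 F) (𝓞 L)) := by
    rw [Ideal.map_span, Set.image_singleton, Ideal.dvd_span_singleton]
    exact hsq
  have hdiff : P ∣ differentIdeal (𝓞 F) (𝓞 L) := by
    simpa using pow_sub_one_dvd_differentIdeal (𝓞 F) P 2 hp0 hdvd
  have h1 := (Ideal.dvd_iff_le.mp hdiff)
    (aeval_derivative_mem_differentIdeal (𝓞 F) F (L := L) c hc)
  have hroot : aeval c ((aPoly d n).map (Int.castRingHom (𝓞 F))) = 0 := by
    have : Int.castRingHom (𝓞 F) = algebraMap ℤ (𝓞 F) := rfl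
    rw [this, aeval_map_algebraMap, aeval_aPoly, hn]
  obtain ⟨q, hq⟩ := minpoly.isIntegrallyClosed_dvd (Algebra.IsIntegral.isIntegral c) hroot
  obtain ⟨r, hr⟩ := exists_derivative_aPoly d hn0
  have h2 := congrArg (fun f => aeval c (derivative f)) hq
  simp only [derivative_map, hr, derivative_mul, map_add, map_mul, minpoly.aeval, zero_mul,
    add_zero, Polynomial.map_add, Polynomial.map_mul, Polynomial.map_one, map_one,
    Polynomial.map_natCast, map_natCast] at h2
  have h3 : (1 : 𝓞 L) ∈ P := by
    rw [eq_sub_of_add_eq h2]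
    exact P.sub_mem (P.mul_mem_right _ h1) (P.mul_mem_right _ hdP)
  exact hPm.ne_top ((Ideal.eq_top_iff_one P).mpr h3)

lemma adjoin_pair_eq_top {F E : Type*} [Field F] [Field E] [Algebra F E] {x y : E}
    (hx : x ∈ IntermediateField.adjoin F {x, y}) (hy : y ∈ IntermediateField.adjoin F {x, y}) :
    IntermediateField.adjoin F
      ({⟨x, hx⟩, ⟨y, hy⟩} : Set (IntermediateField.adjoin F {x, y})) = ⊤ := by
  apply IntermediateField.lift_injective
  rw [IntermediateField.lift_top, IntermediateField.lift_adjoin, Set.image_pair]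

lemma irreducible_fIter_sub_C_root_mul_aSeq {L : Type*} [Field L] [NumberField L] {d : ℕ}
    (hd : d.Prime) {ζ c : L} (hζ : IsPrimitiveRoot ζ d)
    (htop : IntermediateField.adjoin ℚ {c, ζ} = ⊤) {n : ℕ} (hn0 : 0 < n) (hn : aSeq d c n = 0)
    {j ℓ : ℕ} (hj : aSeq d c j ≠ 0) (hℓ : ℓ.Coprime d) (i : ℕ) :
    Irreducible (fIter d c i - C (ζ ^ ℓ * aSeq d c j)) := by
  have := Fact.mk hd
  let F := IntermediateField.adjoin ℚ {ζ}
  have hcyc : IsCyclotomicExtension {d} ℚ F :=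
    hζ.intermediateField_adjoin_isCyclotomicExtension ℚ
  let z : F := ⟨ζ, IntermediateField.mem_adjoin_simple_self ℚ ζ⟩
  have hz : IsPrimitiveRoot z d := IsPrimitiveRoot.coe_submonoidClass_iff.mp hζ
  have hzl : IsPrimitiveRoot (z ^ ℓ) d := hz.pow_of_coprime ℓ hℓ
  obtain ⟨c, rfl⟩ : ∃ x : 𝓞 L, (x : L) = c :=
    ⟨⟨c, isIntegral_of_aSeq_eq_zero hd.two_le hn0 hn⟩, rfl⟩
  have hadj : Algebra.adjoin F {(c : L)} = ⊤ := by
    have h1 : F⟮(c : L)⟯ = ⊤ := by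
      rw [← IntermediateField.restrictScalars_eq_top_iff (K := ℚ)]
      refine (IntermediateField.adjoin_adjoin_left ℚ {ζ} {(c : L)}).trans ?_
      rw [← htop, Set.union_comm, Set.singleton_union]
    rw [← IntermediateField.adjoin_simple_toSubalgebra_of_isAlgebraic
      (Algebra.IsAlgebraic.isAlgebraic _), h1, IntermediateField.top_toSubalgebra]
  have hinj : Function.Injective (algebraMap (𝓞 L) L) := RingOfIntegers.coe_injective
  rw [← map_aSeq, map_eq_zero_iff _ hinj] at hn
  rw [← map_aSeq, Ne, map_eq_zero_iff _ hinj] at hj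
  obtain ⟨P, hP, hdP, hπP, hπP2⟩ := exists_prime_of_cyclotomic hzl hadj hn0 hn
  rw [map_sub, map_one] at hπP hπP2
  exact irreducible_fIter_sub_C_mul_aSeq (K := L) hd hP hdP hπP hπP2 hn0 hn hj i

end NumberField

/-- Let `c₀` be a Gleason parameter of period `n ≥ 2`, `ζ` a primitive
`d`-th root of unity, and `L = K(ζ) = ℚ(c₀, ζ)`. Then for all `i ≥ 1`, `1 ≤ j ≤ n-1` and
`1 ≤ ℓ ≤ d-1`, the polynomial `f_{d,c₀}^i - ζ^ℓ a_j(c₀)` is irreducible over `L`. -/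
theorem stmt19 (d : ℕ) (hd : Nat.Prime d) (ζ : ℂ) (hζ : IsPrimitiveRoot ζ d)
    (n : ℕ) (hn : 2 ≤ n) (c₀ : ℂ) (hc₀ : isGleasonRoot d n c₀)
    (i j ℓ : ℕ) (hi : 1 ≤ i) (hj : 1 ≤ j) (hj' : j ≤ n - 1) (hℓ : 1 ≤ ℓ) (hℓ' : ℓ ≤ d - 1) :
    Irreducible
      (fIter d
          (⟨c₀, IntermediateField.subset_adjoin ℚ {c₀, ζ} (Set.mem_insert c₀ {ζ})⟩ :
            IntermediateField.adjoin ℚ {c₀, ζ}) i -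
        C ((⟨ζ, IntermediateField.subset_adjoin ℚ {c₀, ζ} (Set.mem_insert_of_mem c₀ rfl)⟩ :
              IntermediateField.adjoin ℚ {c₀, ζ}) ^ ℓ *
            aSeq d
              (⟨c₀, IntermediateField.subset_adjoin ℚ {c₀, ζ} (Set.mem_insert c₀ {ζ})⟩ :
                IntermediateField.adjoin ℚ {c₀, ζ}) j)) := by
  have hper := hc₀.exact_period hd.two_le (by omega)
  have hcn : aSeq d c₀ n = 0 := (hper n).mpr dvd_rfl
  have hcj : aSeq d c₀ j ≠ 0 := fun h => by
    have := Nat.le_of_dvd hj ((hper j).mp h)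
    omega
  have hfin : FiniteDimensional ℚ (IntermediateField.adjoin ℚ {c₀, ζ}) := by
    refine IntermediateField.finiteDimensional_adjoin fun x hx => ?_
    obtain rfl | rfl := hx
    · exact (isIntegral_of_aSeq_eq_zero hd.two_le (by omega) hcn).tower_top
    · exact (hζ.isIntegral hd.pos).tower_top
  have : NumberField (IntermediateField.adjoin ℚ {c₀, ζ}) := ⟨⟩
  have hmap : ∀ (x : IntermediateField.adjoin ℚ {c₀, ζ}) m, ((aSeq d x m : IntermediateField.adjoin ℚ {c₀, ζ}) : ℂ) = aSeq d (x : ℂ) m :=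
    fun x m => map_aSeq d (algebraMap (IntermediateField.adjoin ℚ {c₀, ζ}) ℂ) x m
  refine irreducible_fIter_sub_C_root_mul_aSeq hd
    (IsPrimitiveRoot.coe_submonoidClass_iff.mp hζ) ?_ (n := n) (by omega) ?_ ?_ ?_ i
  · exact adjoin_pair_eq_top _ _
  · exact Subtype.ext ((hmap _ n).trans hcn)
  · exact fun h => hcj ((hmap _ j).symm.trans (congrArg Subtype.val h))
  · exact Nat.Coprime.symm ((Nat.Prime.coprime_iff_not_dvd hd).mpr fun h => by
      have := Nat.le_of_dvd hℓ h
      have := hd.pos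
      omega)
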